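/- arXiv:math/0305181 — 3 statements merged into one kernel-verified Lean document; each statement's English description precedes it below -/
import Mathlib

section
/- Let L be a field equipped with an absolute value |·| and let B ⊆ L be a bounded subset. For n ≥ 1 let P_n be the set of monic polynomials of degree n in L[z], set ‖P‖_B := sup_{x∈B} |P(x)|, S_n(B) := inf_{P∈P_n} ‖P‖_B, and s_n(B) := S_n(B)^{1/n}. Then s_n(B) → c(B) as n → ∞. -/
/-- The product of pairwise distances `∏_{i ≠ j} d(x i, x j)`. -/
noncomputable def pairDistProd {α : Type*} (d : α → α → ℝ) {n : ℕ} (x : Fin n → α) : ℝ :=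
  ∏ i : Fin n, ∏ j : Fin n, if i = j then 1 else d (x i) (x j)

/-- The `n`-th diameter `d_n(A)` of a set `A` with respect to a distance function `d`. -/
noncomputable def nthDiam {α : Type*} (d : α → α → ℝ) (A : Set α) (n : ℕ) : ℝ :=
  sSup {r : ℝ | ∃ x : Fin n → α, (∀ i, x i ∈ A) ∧
    r = pairDistProd d x ^ (((n : ℝ) * ((n : ℝ) - 1))⁻¹)}

/-- The transfinite diameter `c(A)`. -/
noncomputable def transDiam {α : Type*} (d : α → α → ℝ) (A : Set α) : ℝ :=
  ⨅ n : ℕ, nthDiam d A (n + 2)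

/-- The sup norm `‖P‖_B = sup_{x ∈ B} v(P(x))` of a polynomial on a set `B`. -/
noncomputable def supNormOn {L : Type*} [Field L] (v : AbsoluteValue L ℝ)
    (B : Set L) (P : Polynomial L) : ℝ :=
  sSup {r : ℝ | ∃ x ∈ B, r = v (Polynomial.eval x P)}

/-- The Chebyshev quantity `S_n(B) = inf { ‖P‖_B : P monic of degree n }`. -/
noncomputable def chebyshevInf {L : Type*} [Field L] (v : AbsoluteValue L ℝ)
    (B : Set L) (n : ℕ) : ℝ :=
  sInf {r : ℝ | ∃ P : Polynomial L, P.Monic ∧ P.natDegree = n ∧ r = supNormOn v B P}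

section PairDist

variable {α : Type*} {d : α → α → ℝ} {A : Set α}

/-- The supremum of the products of pairwise distances over `n`-tuples in `A`. -/
noncomputable def supPairDist (d : α → α → ℝ) (A : Set α) (n : ℕ) : ℝ :=
  sSup {r : ℝ | ∃ x : Fin n → α, (∀ i, x i ∈ A) ∧ r = pairDistProd d x}

theorem pairDistProd_nonneg (hd : ∀ a b, 0 ≤ d a b) {n : ℕ} (x : Fin n → α) :
    0 ≤ pairDistProd d x := by
  refine Finset.prod_nonneg fun i _ => Finset.prod_nonneg fun j _ => ?_
  split_ifs
  · exact zero_le_one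
  · exact hd _ _

theorem pairDistProd_eq_succAbove {n : ℕ} (x : Fin (n + 1) → α) (i : Fin (n + 1)) :
    pairDistProd d x = (∏ k, d (x i) (x (i.succAbove k))) * (∏ k, d (x (i.succAbove k)) (x i)) *
      pairDistProd d (fun k => x (i.succAbove k)) := by
  unfold pairDistProd
  rw [Fin.prod_univ_succAbove _ i, Fin.prod_univ_succAbove _ i]
  simp only [Fin.prod_univ_succAbove _ i, Finset.prod_mul_distrib, if_true, one_mul,
    Fin.succAbove_right_inj, (Fin.succAbove_ne _ _), (Fin.succAbove_ne _ _).symm, if_false]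
  ring

theorem pairDistProd_eq_prod_prod {n : ℕ} (x : Fin (n + 1) → α) :
    pairDistProd d x = ∏ i, ∏ k, d (x i) (x (Fin.succAbove i k)) := by
  unfold pairDistProd
  refine Finset.prod_congr rfl fun i _ => ?_
  rw [Fin.prod_univ_succAbove _ i]
  simp only [if_true, one_mul, (Fin.succAbove_ne _ _).symm, if_false]

theorem pairDistProd_pow_succ (hsymm : ∀ a b, d a b = d b a) {n : ℕ} (x : Fin (n + 1) → α) :
    pairDistProd d x ^ (n + 1) =
      pairDistProd d x ^ 2 * ∏ i, pairDistProd d (fun k => x (Fin.succAbove i k)) := by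
  have h : ∀ i : Fin (n + 1), pairDistProd d x = (∏ k, d (x i) (x (i.succAbove k))) ^ 2 *
      pairDistProd d (fun k => x (i.succAbove k)) := by
    intro i
    rw [pairDistProd_eq_succAbove x i, sq]
    simp only [hsymm (x (i.succAbove _)) (x i)]
  calc pairDistProd d x ^ (n + 1) = ∏ _i : Fin (n + 1), pairDistProd d x := by simp
    _ = ∏ i : Fin (n + 1), ((∏ k, d (x i) (x (i.succAbove k))) ^ 2 *
        pairDistProd d (fun k => x (i.succAbove k))) := Finset.prod_congr rfl fun i _ => h i
    _ = _ := by
      rw [Finset.prod_mul_distrib, Finset.prod_pow, ← pairDistProd_eq_prod_prod]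

theorem bddAbove_pairDistProd (hd : ∀ a b, 0 ≤ d a b) {K : ℝ}
    (hK : ∀ a ∈ A, ∀ b ∈ A, d a b ≤ K) (n : ℕ) :
    BddAbove {r : ℝ | ∃ x : Fin n → α, (∀ i, x i ∈ A) ∧ r = pairDistProd d x} := by
  refine ⟨∏ _i : Fin n, ∏ _j : Fin n, max 1 K, ?_⟩
  rintro r ⟨x, hx, rfl⟩
  have hnn : ∀ i j : Fin n, 0 ≤ if i = j then 1 else d (x i) (x j) := by
    intro i j
    split_ifs
    · exact zero_le_one
    · exact hd _ _
  refine Finset.prod_le_prod (fun i _ => Finset.prod_nonneg fun j _ => hnn i j) fun i _ =>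
    Finset.prod_le_prod (fun j _ => hnn i j) fun j _ => ?_
  split_ifs
  · exact le_max_left _ _
  · exact (hK _ (hx i) _ (hx j)).trans (le_max_right _ _)

theorem supPairDist_nonneg (hd : ∀ a b, 0 ≤ d a b) (n : ℕ) : 0 ≤ supPairDist d A n := by
  refine Real.sSup_nonneg ?_
  rintro r ⟨x, -, rfl⟩
  exact pairDistProd_nonneg hd x

theorem pairDistProd_le_supPairDist (hd : ∀ a b, 0 ≤ d a b) {K : ℝ}
    (hK : ∀ a ∈ A, ∀ b ∈ A, d a b ≤ K) {n : ℕ} {x : Fin n → α} (hx : ∀ i, x i ∈ A) :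
    pairDistProd d x ≤ supPairDist d A n :=
  le_csSup (bddAbove_pairDistProd hd hK n) ⟨x, hx, rfl⟩

theorem supPairDist_le (hA : A.Nonempty) {n : ℕ} {c : ℝ}
    (h : ∀ x : Fin n → α, (∀ i, x i ∈ A) → pairDistProd d x ≤ c) : supPairDist d A n ≤ c := by
  obtain ⟨a, ha⟩ := hA
  refine csSup_le ⟨_, fun _ => a, fun _ => ha, rfl⟩ ?_
  rintro r ⟨x, hx, rfl⟩
  exact h x hx

theorem supPairDist_zero : supPairDist d A 0 = 1 := by
  have : {r : ℝ | ∃ x : Fin 0 → α, (∀ i, x i ∈ A) ∧ r = pairDistProd d x} = {1} := by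
    ext r
    simp [pairDistProd]
  rw [supPairDist, this, csSup_singleton]

theorem nthDiam_eq_supPairDist_rpow (hd : ∀ a b, 0 ≤ d a b) {K : ℝ}
    (hK : ∀ a ∈ A, ∀ b ∈ A, d a b ≤ K) (hA : A.Nonempty) (m : ℕ) :
    nthDiam d A (m + 2) = supPairDist d A (m + 2) ^ (((m : ℝ) + 2) * (m + 1))⁻¹ := by
  have he : (((m + 2 : ℕ) : ℝ) * (((m + 2 : ℕ) : ℝ) - 1))⁻¹ = (((m : ℝ) + 2) * (m + 1))⁻¹ := by
    push_cast
    ring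
  have hpos : 0 < (((m : ℝ) + 2) * (m + 1))⁻¹ := by positivity
  have hub : ∀ x : Fin (m + 2) → α, (∀ i, x i ∈ A) → pairDistProd d x ^
      (((m : ℝ) + 2) * (m + 1))⁻¹ ≤ supPairDist d A (m + 2) ^ (((m : ℝ) + 2) * (m + 1))⁻¹ :=
    fun x hx => Real.rpow_le_rpow (pairDistProd_nonneg hd x)
      (pairDistProd_le_supPairDist hd hK hx) hpos.le
  unfold nthDiam
  rw [he]
  apply le_antisymm
  · obtain ⟨a, ha⟩ := hA
    refine csSup_le ⟨_, fun _ => a, fun _ => ha, rfl⟩ ?_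
    rintro r ⟨x, hx, rfl⟩
    exact hub x hx
  · have hle : ∀ x : Fin (m + 2) → α, (∀ i, x i ∈ A) →
        pairDistProd d x ^ (((m : ℝ) + 2) * (m + 1))⁻¹ ≤ sSup {r : ℝ | ∃ x : Fin (m + 2) → α,
          (∀ i, x i ∈ A) ∧ r = pairDistProd d x ^ (((m : ℝ) + 2) * (m + 1))⁻¹} := by
      refine fun x hx => le_csSup
        ⟨supPairDist d A (m + 2) ^ (((m : ℝ) + 2) * (m + 1))⁻¹, ?_⟩ ⟨x, hx, rfl⟩
      rintro r ⟨y, hy, rfl⟩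
      exact hub y hy
    have hnn : 0 ≤ sSup {r : ℝ | ∃ x : Fin (m + 2) → α,
        (∀ i, x i ∈ A) ∧ r = pairDistProd d x ^ (((m : ℝ) + 2) * (m + 1))⁻¹} := by
      refine Real.sSup_nonneg ?_
      rintro r ⟨x, -, rfl⟩
      exact Real.rpow_nonneg (pairDistProd_nonneg hd x) _
    rw [Real.rpow_inv_le_iff_of_pos (supPairDist_nonneg hd _) hnn (by positivity)]
    refine supPairDist_le hA fun x hx => ?_
    rw [← Real.rpow_inv_le_iff_of_pos (pairDistProd_nonneg hd x) hnn (by positivity)]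
    exact hle x hx

theorem supPairDist_succ_le_rpow (hd : ∀ a b, 0 ≤ d a b) (hsymm : ∀ a b, d a b = d b a) {K : ℝ}
    (hK : ∀ a ∈ A, ∀ b ∈ A, d a b ≤ K) (hA : A.Nonempty) (m : ℕ) :
    supPairDist d A (m + 3) ≤ supPairDist d A (m + 2) ^ (((m : ℝ) + 3) / (m + 1)) := by
  have hW := supPairDist_nonneg (A := A) hd (m + 2)
  refine supPairDist_le hA fun x hx => ?_
  have hQ := pairDistProd_nonneg hd x
  rcases hQ.eq_or_lt with h0 | hpos
  · rw [← h0]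
    exact Real.rpow_nonneg hW _
  have hpow : pairDistProd d x ^ (m + 1) ≤ supPairDist d A (m + 2) ^ (m + 3) := by
    have h := pairDistProd_pow_succ hsymm x
    have h2 : pairDistProd d x ^ (m + 1) =
        ∏ i, pairDistProd d (fun k => x (Fin.succAbove i k)) := by
      refine mul_left_cancel₀ (pow_pos hpos 2).ne' ?_
      rw [← h]
      ring
    rw [h2]
    calc _ ≤ ∏ _i : Fin (m + 3), supPairDist d A (m + 2) :=
          Finset.prod_le_prod (fun i _ => pairDistProd_nonneg hd _)
            fun i _ => pairDistProd_le_supPairDist hd hK fun k => hx _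
      _ = _ := by simp
  have hm : (0 : ℝ) < (m : ℝ) + 1 := by positivity
  rw [div_eq_mul_inv, Real.rpow_mul hW, Real.le_rpow_inv_iff_of_pos hQ (by positivity) hm]
  exact_mod_cast hpow

theorem nthDiam_succ_le (hd : ∀ a b, 0 ≤ d a b) (hsymm : ∀ a b, d a b = d b a) {K : ℝ}
    (hK : ∀ a ∈ A, ∀ b ∈ A, d a b ≤ K) (hA : A.Nonempty) (m : ℕ) :
    nthDiam d A (m + 1 + 2) ≤ nthDiam d A (m + 2) := by
  have hW := supPairDist_nonneg (A := A) hd (m + 2)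
  rw [nthDiam_eq_supPairDist_rpow hd hK hA, nthDiam_eq_supPairDist_rpow hd hK hA]
  refine (Real.rpow_le_rpow (supPairDist_nonneg hd _)
    (supPairDist_succ_le_rpow hd hsymm hK hA m) (by positivity)).trans_eq ?_
  rw [← Real.rpow_mul hW]
  congr 1
  push_cast
  field_simp
  ring

theorem tendsto_nthDiam (hd : ∀ a b, 0 ≤ d a b) (hsymm : ∀ a b, d a b = d b a) {K : ℝ}
    (hK : ∀ a ∈ A, ∀ b ∈ A, d a b ≤ K) (hA : A.Nonempty) :
    Filter.Tendsto (fun m : ℕ => nthDiam d A (m + 2)) Filter.atTop (nhds (transDiam d A)) := by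
  refine tendsto_atTop_ciInf (antitone_nat_of_succ_le (nthDiam_succ_le hd hsymm hK hA)) ⟨0, ?_⟩
  rintro _ ⟨m, rfl⟩
  simp only [nthDiam_eq_supPairDist_rpow hd hK hA]
  exact Real.rpow_nonneg (supPairDist_nonneg hd _) _

end PairDist

section Chebyshev

variable {L : Type*} [Field L] {v : AbsoluteValue L ℝ} {B : Set L}

theorem bddAbove_abv_eval {M : ℝ} (hM : ∀ x ∈ B, v x ≤ M) (P : Polynomial L) :
    BddAbove {r : ℝ | ∃ x ∈ B, r = v (Polynomial.eval x P)} := by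
  refine ⟨∑ i ∈ Finset.range (P.natDegree + 1), v (P.coeff i) * M ^ i, ?_⟩
  rintro r ⟨x, hx, rfl⟩
  rw [Polynomial.eval_eq_sum_range]
  refine (v.sum_le _ _).trans (Finset.sum_le_sum fun i _ => ?_)
  rw [map_mul, map_pow]
  exact mul_le_mul_of_nonneg_left (pow_le_pow_left₀ (v.nonneg x) (hM x hx) i) (v.nonneg _)

theorem supNormOn_nonneg (P : Polynomial L) : 0 ≤ supNormOn v B P := by
  refine Real.sSup_nonneg ?_
  rintro r ⟨x, -, rfl⟩
  exact v.nonneg _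

theorem abv_eval_le_supNormOn {M : ℝ} (hM : ∀ x ∈ B, v x ≤ M) (P : Polynomial L) {x : L}
    (hx : x ∈ B) : v (P.eval x) ≤ supNormOn v B P :=
  le_csSup (bddAbove_abv_eval hM P) ⟨x, hx, rfl⟩

theorem supNormOn_le {P : Polynomial L} {c : ℝ} (hc : 0 ≤ c) (h : ∀ x ∈ B, v (P.eval x) ≤ c) :
    supNormOn v B P ≤ c := by
  refine Real.sSup_le ?_ hc
  rintro r ⟨x, hx, rfl⟩
  exact h x hx

theorem chebyshevInf_nonneg (n : ℕ) : 0 ≤ chebyshevInf v B n := by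
  refine Real.sInf_nonneg ?_
  rintro r ⟨P, -, -, rfl⟩
  exact supNormOn_nonneg P

theorem chebyshevInf_le_supNormOn {P : Polynomial L} (hP : P.Monic) :
    chebyshevInf v B P.natDegree ≤ supNormOn v B P := by
  refine csInf_le ⟨0, ?_⟩ ⟨P, hP, rfl, rfl⟩
  rintro r ⟨P, -, -, rfl⟩
  exact supNormOn_nonneg P

theorem le_chebyshevInf_mul {n : ℕ} {b c : ℝ} (hb : 0 ≤ b)
    (h : ∀ P : Polynomial L, P.Monic → P.natDegree = n → c ≤ supNormOn v B P * b) :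
    c ≤ chebyshevInf v B n * b := by
  have hX : (Polynomial.X ^ n : Polynomial L).natDegree = n := Polynomial.natDegree_X_pow n
  rcases hb.eq_or_lt with rfl | hb
  · simpa using h _ (Polynomial.monic_X_pow n) hX
  · rw [← div_le_iff₀ hb]
    refine le_csInf ⟨_, _, Polynomial.monic_X_pow n, hX, rfl⟩ ?_
    rintro r ⟨P, hP, hn, rfl⟩
    rw [div_le_iff₀ hb]
    exact h P hP hn

theorem chebyshevInf_add_le {M : ℝ} (hM : ∀ x ∈ B, v x ≤ M) (m n : ℕ) :
    chebyshevInf v B (m + n) ≤ chebyshevInf v B m * chebyshevInf v B n := by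
  refine le_chebyshevInf_mul (chebyshevInf_nonneg n) fun P hP hPm => ?_
  rw [mul_comm]
  refine le_chebyshevInf_mul (supNormOn_nonneg P) fun Q hQ hQn => ?_
  rw [← hPm, ← hQn, ← hP.natDegree_mul hQ]
  refine (chebyshevInf_le_supNormOn (hP.mul hQ)).trans
    (supNormOn_le (mul_nonneg (supNormOn_nonneg _) (supNormOn_nonneg _)) fun x hx => ?_)
  rw [Polynomial.eval_mul, map_mul, mul_comm]
  exact mul_le_mul (abv_eval_le_supNormOn hM Q hx) (abv_eval_le_supNormOn hM P hx)
    (v.nonneg _) (supNormOn_nonneg _)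

theorem pairDistProd_abv_cons {n : ℕ} (z : L) (x : Fin n → L) :
    pairDistProd (fun a b => v (a - b)) (Fin.cons z x : Fin (n + 1) → L) =
      v (∏ i, (z - x i)) ^ 2 * pairDistProd (fun a b => v (a - b)) x := by
  rw [pairDistProd_eq_succAbove _ 0]
  simp only [Fin.succAbove_zero, Fin.cons_zero, Fin.cons_succ, v.map_sub _ z, ← map_prod, sq]

theorem abv_det_vandermonde_sq {n : ℕ} (x : Fin n → L) :
    v (Matrix.vandermonde x).det ^ 2 = pairDistProd (fun a b => v (a - b)) x := by
  induction n with
  | zero => simp [pairDistProd]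
  | succ n ih =>
    obtain ⟨z, y, rfl⟩ : ∃ z y, x = (Fin.cons z y : Fin (n + 1) → L) :=
      ⟨x 0, Fin.tail x, (Fin.cons_self_tail x).symm⟩
    rw [pairDistProd_abv_cons, ← ih, ← mul_pow, ← map_mul, Matrix.det_vandermonde,
      Matrix.det_vandermonde, Fin.prod_univ_succ]
    simp only [Fin.prod_Ioi_zero, Fin.prod_Ioi_succ, Fin.cons_zero, Fin.cons_succ, map_mul,
      map_prod, v.map_sub _ z]

theorem chebyshevInf_sq_mul_supPairDist_le {K : ℝ}
    (hK : ∀ a ∈ B, ∀ b ∈ B, v (a - b) ≤ K) (hB : B.Nonempty) (n : ℕ) :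
    chebyshevInf v B n ^ 2 * supPairDist (fun a b => v (a - b)) B n ≤
      supPairDist (fun a b => v (a - b)) B (n + 1) := by
  have hd : ∀ a b : L, 0 ≤ v (a - b) := fun a b => v.nonneg _
  have hW := supPairDist_nonneg (A := B) hd (n + 1)
  have key : ∀ x : Fin n → L, (∀ i, x i ∈ B) → chebyshevInf v B n ^ 2 *
      pairDistProd (fun a b => v (a - b)) x ≤ supPairDist (fun a b => v (a - b)) B (n + 1) := by
    intro x hx
    have hQ : 0 ≤ pairDistProd (fun a b => v (a - b)) x := pairDistProd_nonneg hd x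
    rcases hQ.eq_or_lt with h0 | hpos
    · rw [← h0, mul_zero]
      exact hW
    rw [← le_div_iff₀ hpos]
    refine (Real.le_sqrt (chebyshevInf_nonneg n) (by positivity)).1 ?_
    have hmon : (∏ i, (Polynomial.X - Polynomial.C (x i))).Monic :=
      Polynomial.monic_prod_of_monic _ _ fun i _ => Polynomial.monic_X_sub_C _
    have hdeg : (∏ i, (Polynomial.X - Polynomial.C (x i))).natDegree = n := by
      rw [Polynomial.natDegree_prod_of_monic _ _ fun i _ => Polynomial.monic_X_sub_C _]
      simp
    have h1 := chebyshevInf_le_supNormOn (v := v) (B := B) hmon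
    rw [hdeg] at h1
    refine h1.trans (supNormOn_le (Real.sqrt_nonneg _) fun z hz => ?_)
    refine Real.le_sqrt_of_sq_le ?_
    rw [le_div_iff₀ hpos]
    have h2 := pairDistProd_abv_cons (v := v) z x
    rw [Polynomial.eval_prod]
    simp only [Polynomial.eval_sub, Polynomial.eval_X, Polynomial.eval_C]
    rw [← h2]
    refine pairDistProd_le_supPairDist hd hK fun i => ?_
    refine Fin.cases ?_ (fun j => ?_) i
    · simpa using hz
    · simpa using hx j
  rcases (sq_nonneg (chebyshevInf v B n)).eq_or_lt with h0 | hpos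
  · rw [← h0, zero_mul]
    exact hW
  · rw [mul_comm, ← le_div_iff₀ hpos]
    refine supPairDist_le hB fun x hx => ?_
    rw [le_div_iff₀ hpos, mul_comm]
    exact key x hx

theorem abv_det_vandermonde_succ_le {n : ℕ} {P : Polynomial L} (hP : P.Monic)
    (hn : P.natDegree = n) (x : Fin (n + 1) → L) :
    v (Matrix.vandermonde x).det ≤
      ∑ i, v (P.eval (x i)) * v (Matrix.vandermonde fun k => x (Fin.succAbove i k)).det := by
  let p : Fin (n + 1) → Polynomial L := Fin.snoc (fun j : Fin n => Polynomial.X ^ (j : ℕ)) P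
  have hdeg : ∀ j, (p j).natDegree = j := by
    intro j
    refine Fin.lastCases ?_ (fun k => ?_) j <;> simp [p, hn]
  have hmon : ∀ j, (p j).Monic := by
    intro j
    refine Fin.lastCases ?_ (fun k => ?_) j
    · simpa [p] using hP
    · simp [p]
  rw [Matrix.det_eval_matrixOfPolynomials_eq_det_vandermonde x p hdeg hmon,
    Matrix.det_succ_column _ (Fin.last n)]
  refine (v.sum_le _ _).trans_eq (Finset.sum_congr rfl fun i _ => ?_)
  rw [map_mul, map_mul, map_pow, v.map_neg, map_one, one_pow, one_mul]
  congr 2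
  · simp [p]
  · congr 1
    ext k j
    simp [p, Matrix.vandermonde_apply]

theorem supPairDist_succ_le {M K : ℝ} (hM : ∀ x ∈ B, v x ≤ M)
    (hK : ∀ a ∈ B, ∀ b ∈ B, v (a - b) ≤ K) (hB : B.Nonempty) (n : ℕ) :
    supPairDist (fun a b => v (a - b)) B (n + 1) ≤
      (((n : ℝ) + 1) * chebyshevInf v B n) ^ 2 * supPairDist (fun a b => v (a - b)) B n := by
  have hd : ∀ a b : L, 0 ≤ v (a - b) := fun a b => v.nonneg _
  have hW := supPairDist_nonneg (A := B) hd n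
  have hsqrt : ∀ (m : ℕ) (x : Fin m → L), (∀ i, x i ∈ B) → v (Matrix.vandermonde x).det ≤
      √(supPairDist (fun a b => v (a - b)) B m) := by
    intro m x hx
    refine Real.le_sqrt_of_sq_le ?_
    rw [abv_det_vandermonde_sq]
    exact pairDistProd_le_supPairDist hd hK hx
  refine supPairDist_le hB fun x hx => ?_
  rw [← abv_det_vandermonde_sq]
  have key : v (Matrix.vandermonde x).det ≤ chebyshevInf v B n *
      (((n : ℝ) + 1) * √(supPairDist (fun a b => v (a - b)) B n)) := by
    refine le_chebyshevInf_mul (by positivity) fun P hP hPn => ?_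
    calc _ ≤ _ := abv_det_vandermonde_succ_le hP hPn x
      _ ≤ ∑ _i : Fin (n + 1), supNormOn v B P * √(supPairDist (fun a b => v (a - b)) B n) :=
        Finset.sum_le_sum fun i _ => mul_le_mul (abv_eval_le_supNormOn hM P (hx i))
          (hsqrt n _ fun k => hx _) (v.nonneg _) (supNormOn_nonneg P)
      _ = _ := by
        simp
        ring
  calc _ ≤ _ := pow_le_pow_left₀ (v.nonneg _) key 2
    _ = (((n : ℝ) + 1) * chebyshevInf v B n) ^ 2 *
        √(supPairDist (fun a b => v (a - b)) B n) ^ 2 := by ring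
    _ = _ := by rw [Real.sq_sqrt hW]

theorem chebyshevInf_eq_zero_of_supPairDist_eq_zero {M K : ℝ} (hM : ∀ x ∈ B, v x ≤ M)
    (hK : ∀ a ∈ B, ∀ b ∈ B, v (a - b) ≤ K) (hB : B.Nonempty) (n : ℕ)
    (h : supPairDist (fun a b => v (a - b)) B n = 0) : chebyshevInf v B n = 0 := by
  have hd : ∀ a b : L, 0 ≤ v (a - b) := fun a b => v.nonneg _
  induction n with
  | zero => simp [supPairDist_zero] at h
  | succ n ih =>
    have hn : chebyshevInf v B n = 0 := by
      by_cases h0 : supPairDist (fun a b => v (a - b)) B n = 0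
      · exact ih h0
      · have h1 := chebyshevInf_sq_mul_supPairDist_le hK hB n
        rw [h] at h1
        have hpos := lt_of_le_of_ne (supPairDist_nonneg (A := B) hd n) (Ne.symm h0)
        have h2 : chebyshevInf v B n ^ 2 ≤ 0 := nonpos_of_mul_nonpos_left h1 hpos
        exact pow_eq_zero_iff two_ne_zero |>.1 (le_antisymm h2 (sq_nonneg _))
    have h3 := chebyshevInf_add_le hM n 1
    rw [hn, zero_mul] at h3
    exact le_antisymm h3 (chebyshevInf_nonneg _)

theorem chebyshevInf_rpow_le_nthDiam {M K : ℝ} (hM : ∀ x ∈ B, v x ≤ M)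
    (hK : ∀ a ∈ B, ∀ b ∈ B, v (a - b) ≤ K) (hB : B.Nonempty) (m : ℕ) :
    chebyshevInf v B (m + 2) ^ (((m + 2 : ℕ) : ℝ)⁻¹) ≤
      nthDiam (fun a b => v (a - b)) B (m + 2) := by
  have hd : ∀ a b : L, 0 ≤ v (a - b) := fun a b => v.nonneg _
  have hW := supPairDist_nonneg (A := B) hd (m + 2)
  have hS := chebyshevInf_nonneg (v := v) (B := B) (m + 2)
  rw [nthDiam_eq_supPairDist_rpow hd hK hB]
  rcases hW.eq_or_lt with h0 | hpos
  · rw [chebyshevInf_eq_zero_of_supPairDist_eq_zero hM hK hB _ h0.symm,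
      Real.zero_rpow (by positivity)]
    positivity
  have h1 := (chebyshevInf_sq_mul_supPairDist_le hK hB (m + 2)).trans
    (supPairDist_succ_le_rpow hd (fun a b => v.map_sub a b) hK hB m)
  rw [← le_div_iff₀ hpos] at h1
  generalize supPairDist (fun a b => v (a - b)) B (m + 2) = W at *
  have hm : (0 : ℝ) < (m : ℝ) + 1 := by positivity
  have h2 : W ^ (((m : ℝ) + 3) / (m + 1)) / W = (W ^ (((m : ℝ) + 1)⁻¹)) ^ 2 := by
    rw [← Real.rpow_natCast, ← Real.rpow_mul hW, ← Real.rpow_sub_one hpos.ne']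
    congr 1
    push_cast
    field_simp
    ring
  rw [h2] at h1
  have h3 := (pow_le_pow_iff_left₀ hS (by positivity) two_ne_zero).1 h1
  calc _ ≤ _ := Real.rpow_le_rpow hS h3 (by positivity)
    _ = _ := by
      rw [← Real.rpow_mul hW]
      congr 1
      push_cast
      field_simp

theorem exists_chebyshevInf_le_mul_pow {M : ℝ} (hM : ∀ x ∈ B, v x ≤ M) {k : ℕ} (hk : 0 < k)
    {a : ℝ} (ha : 0 < a) (hka : chebyshevInf v B k ≤ a ^ k) :
    ∃ C : ℝ, 0 < C ∧ ∀ j, chebyshevInf v B j ≤ C * a ^ j := by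
  have hnn : ∀ r : ℕ, 0 ≤ chebyshevInf v B r / a ^ r := fun r =>
    div_nonneg (chebyshevInf_nonneg r) (by positivity)
  refine ⟨1 + ∑ r ∈ Finset.range k, chebyshevInf v B r / a ^ r,
    add_pos_of_pos_of_nonneg one_pos (Finset.sum_nonneg fun r _ => hnn r), fun j => ?_⟩
  induction j using Nat.strong_induction_on with
  | _ j ih =>
    rcases lt_or_ge j k with hj | hj
    · rw [← div_le_iff₀ (by positivity)]
      have := Finset.single_le_sum (f := fun r => chebyshevInf v B r / a ^ r)
        (fun r _ => hnn r) (Finset.mem_range.2 hj)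
      linarith
    · obtain ⟨i, rfl⟩ := Nat.exists_eq_add_of_le hj
      calc _ ≤ _ := chebyshevInf_add_le hM k i
        _ ≤ _ := mul_le_mul hka (ih i (by omega)) (chebyshevInf_nonneg i) (by positivity)
        _ = _ := by ring

theorem supPairDist_le_pow {M K : ℝ} (hM : ∀ x ∈ B, v x ≤ M)
    (hK : ∀ a ∈ B, ∀ b ∈ B, v (a - b) ≤ K) (hB : B.Nonempty) {a C : ℝ} (ha : 0 < a) (hC : 0 < C)
    (h : ∀ j, chebyshevInf v B j ≤ C * a ^ j) (n : ℕ) :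
    supPairDist (fun a b => v (a - b)) B (n + 1) ≤
      (((n : ℝ) + 1) * C) ^ (2 * (n + 1)) * a ^ ((n + 1) * n) := by
  have hd : ∀ a b : L, 0 ≤ v (a - b) := fun a b => v.nonneg _
  have hstep : ∀ n : ℕ, supPairDist (fun a b => v (a - b)) B (n + 1) ≤
      (((n : ℝ) + 1) * (C * a ^ n)) ^ 2 * supPairDist (fun a b => v (a - b)) B n := by
    intro n
    refine (supPairDist_succ_le hM hK hB n).trans ?_
    have := chebyshevInf_nonneg (v := v) (B := B) n
    have := supPairDist_nonneg (A := B) hd n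
    gcongr
    exact h n
  induction n with
  | zero =>
    have := hstep 0
    rw [supPairDist_zero] at this
    simpa using this
  | succ n ih =>
    refine (hstep (n + 1)).trans ?_
    calc _ ≤ ((((n + 1 : ℕ) : ℝ) + 1) * (C * a ^ (n + 1))) ^ 2 *
          (((((n + 1 : ℕ) : ℝ) + 1) * C) ^ (2 * (n + 1)) * a ^ ((n + 1) * n)) := by
            refine mul_le_mul_of_nonneg_left (ih.trans ?_) (by positivity)
            gcongr
            simp
      _ = _ := by ring

theorem transDiam_le_of_chebyshevInf_le {M K : ℝ} (hM : ∀ x ∈ B, v x ≤ M)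
    (hK : ∀ a ∈ B, ∀ b ∈ B, v (a - b) ≤ K) (hB : B.Nonempty) {k : ℕ} (hk : 0 < k)
    {a : ℝ} (ha : 0 < a) (hka : chebyshevInf v B k ≤ a ^ k) :
    transDiam (fun a b => v (a - b)) B ≤ a := by
  have hd : ∀ a b : L, 0 ≤ v (a - b) := fun a b => v.nonneg _
  obtain ⟨C, hC, h⟩ := exists_chebyshevInf_le_mul_pow hM hk ha hka
  have hle : ∀ m : ℕ, nthDiam (fun a b => v (a - b)) B (m + 2) ≤
      (((m : ℝ) + 2) * C) ^ (2 / (C⁻¹ * (((m : ℝ) + 2) * C) + -1)) * a := by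
    intro m
    rw [nthDiam_eq_supPairDist_rpow hd hK hB]
    have h1 := supPairDist_le_pow hM hK hB ha hC h (m + 1)
    refine (Real.rpow_le_rpow (supPairDist_nonneg hd _) h1 (by positivity)).trans_eq ?_
    have e : (((m + 1 : ℕ) : ℝ) + 1) = (m : ℝ) + 2 := by
      push_cast
      ring
    rw [e, Real.mul_rpow (by positivity) (by positivity), ← Real.rpow_natCast,
      ← Real.rpow_natCast, ← Real.rpow_mul (by positivity), ← Real.rpow_mul ha.le]
    have e1 : ((2 * (m + 1 + 1) : ℕ) : ℝ) * (((m : ℝ) + 2) * (m + 1))⁻¹ =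
        2 / (C⁻¹ * (((m : ℝ) + 2) * C) + -1) := by
      have : C⁻¹ * (((m : ℝ) + 2) * C) + -1 = m + 1 := by
        field_simp
        ring
      rw [this]
      push_cast
      field_simp
      ring
    have e2 : (((m + 1 + 1) * (m + 1) : ℕ) : ℝ) * (((m : ℝ) + 2) * (m + 1))⁻¹ = 1 := by
      push_cast
      field_simp
      ring
    rw [e1, e2, Real.rpow_one]
  have hlim : Filter.Tendsto (fun m : ℕ => ((m : ℝ) + 2) * C) Filter.atTop Filter.atTop :=
    (Filter.tendsto_atTop_add_const_right _ _ tendsto_natCast_atTop_atTop).atTop_mul_const hC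
  have h2 := ((tendsto_rpow_div_mul_add 2 C⁻¹ (-1) (inv_pos.2 hC).ne).comp hlim).mul_const a
  rw [one_mul] at h2
  exact le_of_tendsto_of_tendsto' (tendsto_nthDiam hd (fun a b => v.map_sub a b) hK hB) h2 hle

theorem transDiam_le_chebyshevInf_rpow {M K : ℝ} (hM : ∀ x ∈ B, v x ≤ M)
    (hK : ∀ a ∈ B, ∀ b ∈ B, v (a - b) ≤ K) (hB : B.Nonempty) {k : ℕ} (hk : 0 < k) :
    transDiam (fun a b => v (a - b)) B ≤ chebyshevInf v B k ^ ((k : ℝ)⁻¹) := by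
  have hS := chebyshevInf_nonneg (v := v) (B := B) k
  refine le_of_forall_gt_imp_ge_of_dense fun a ha => ?_
  have ha0 : 0 < a := (Real.rpow_nonneg hS _).trans_lt ha
  refine transDiam_le_of_chebyshevInf_le hM hK hB hk ha0 ?_
  have h := (Real.rpow_inv_le_iff_of_pos hS ha0.le (Nat.cast_pos.2 hk)).1 ha.le
  exact_mod_cast h

end Chebyshev

theorem transDiam_empty {α : Type*} (d : α → α → ℝ) : transDiam d ∅ = 0 := by
  simp [transDiam, nthDiam]

theorem chebyshevInf_empty {L : Type*} [Field L] (v : AbsoluteValue L ℝ) (n : ℕ) :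
    chebyshevInf v ∅ n = 0 := by
  refine le_antisymm ?_ (chebyshevInf_nonneg n)
  have h := chebyshevInf_le_supNormOn (v := v) (B := ∅) (Polynomial.monic_X_pow (R := L) n)
  rw [Polynomial.natDegree_X_pow] at h
  exact h.trans (supNormOn_le le_rfl (by simp))

/-- For a bounded subset `B` of a field with absolute value `v`,
the Chebyshev constants `s_n(B) = S_n(B)^(1/n)` converge to the transfinite diameter
`c(B)` as `n → ∞`. -/
theorem stmt3 {L : Type*} [Field L] (v : AbsoluteValue L ℝ)
    (B : Set L) (hB : ∃ M : ℝ, ∀ x ∈ B, v x ≤ M) :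
    Filter.Tendsto (fun n : ℕ => chebyshevInf v B n ^ ((n : ℝ)⁻¹))
      Filter.atTop (nhds (transDiam (fun x y => v (x - y)) B)) := by
  obtain ⟨M, hM⟩ := hB
  rw [← Filter.tendsto_add_atTop_iff_nat 2]
  rcases B.eq_empty_or_nonempty with rfl | hB
  · simp only [transDiam_empty, chebyshevInf_empty]
    refine tendsto_const_nhds.congr fun n => ?_
    rw [Real.zero_rpow (by positivity)]
  have hd : ∀ a b : L, 0 ≤ v (a - b) := fun a b => v.nonneg _
  have hK : ∀ a ∈ B, ∀ b ∈ B, v (a - b) ≤ M + M := fun a ha b hb =>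
    (v.sub_le_add a b).trans (add_le_add (hM a ha) (hM b hb))
  exact tendsto_of_tendsto_of_tendsto_of_le_of_le tendsto_const_nhds
    (tendsto_nthDiam hd (fun a b => v.map_sub a b) hK hB)
    (fun m => transDiam_le_chebyshevInf_rpow hM hK hB (Nat.succ_pos _))
    (fun m => chebyshevInf_rpow_le_nthDiam hM hK hB m)
end

section
/- Let L be an algebraically closed field complete with respect to a nontrivial non-archimedean absolute value |·|, let φ ∈ L[z] be a polynomial of degree d ≥ 1 with leading coefficient a_d, and let M > 0 be an element of the value group |L^×|. Then the lemniscate B := {z ∈ L : |φ(z)| ≤ M} has transfinite diameter c(B) = (M/|a_d|)^{1/d}. In particular (taking φ(z) = z), the closed disc {z ∈ L : |z| ≤ M} has transfinite diameter M. -/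
theorem pairDistProd_cons {α : Type*} {d : α → α → ℝ} (hd : ∀ a b, d a b = d b a) {n : ℕ}
    (a : α) (x : Fin n → α) :
    pairDistProd d (Fin.cons a x : Fin (n + 1) → α) =
      (∏ j, d a (x j)) ^ 2 * pairDistProd d x := by
  simp [pairDistProd, Fin.prod_univ_succ, Finset.prod_mul_distrib, hd _ a,
    (Fin.succ_ne_zero _).symm, sq, mul_assoc]

theorem pairDistProd_eq_norm_det_vandermonde_sq {L : Type*} [NormedField L] {n : ℕ}
    (x : Fin n → L) :
    pairDistProd (fun x y => ‖x - y‖) x = ‖(Matrix.vandermonde x).det‖ ^ 2 := by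
  rw [Matrix.det_vandermonde]
  induction n with
  | zero => simp [pairDistProd]
  | succ n ih =>
    have h := pairDistProd_cons (fun a b : L => norm_sub_rev a b) (x 0) (Fin.tail x)
    rw [Fin.cons_self_tail, ih] at h
    rw [h]
    simp [Fin.prod_univ_succ, Fin.prod_Ioi_succ, norm_sub_rev (x 0), mul_pow, Fin.tail]

theorem Multiset.exists_le_of_pow_card_le_prod {α : Type*} {t : Multiset α} {f : α → ℝ} {c : ℝ}
    (ht : t ≠ 0) (hf : ∀ x, 0 ≤ f x) (h : c ^ t.card ≤ (t.map f).prod) :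
    ∃ x ∈ t, c ≤ f x := by
  induction t using Multiset.induction with
  | empty => exact absurd rfl ht
  | cons a t ih =>
    by_cases ha : c ≤ f a
    · exact ⟨a, by simp, ha⟩
    · push Not at ha
      have hc' : 0 < c := (hf a).trans_lt ha
      rw [Multiset.card_cons, Multiset.map_cons, Multiset.prod_cons, pow_succ'] at h
      by_cases ht0 : t = 0
      · subst ht0; simp at h; linarith
      · obtain ⟨x, hx, hcx⟩ := ih ht0 (by
          have : c * c ^ t.card ≤ c * (t.map f).prod := h.trans (by
            have : 0 ≤ (t.map f).prod := Multiset.prod_nonneg (by simp [hf])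
            gcongr)
          exact le_of_mul_le_mul_left this hc')
        exact ⟨x, by simp [hx], hcx⟩

theorem IsUltrametricDist.norm_sub_le_max_norm {E : Type*} [SeminormedAddGroup E]
    [IsUltrametricDist E] (x y : E) : ‖x - y‖ ≤ max ‖x‖ ‖y‖ := by
  simpa [sub_eq_add_neg] using IsUltrametricDist.norm_add_le_max x (-y)

open Polynomial in
theorem exists_norm_le_forall_le_norm_sub {L : Type*} [NormedField L] [IsAlgClosed L]
    [IsUltrametricDist L] {n : ℕ} (c : Fin n → L) {b : L} (hb : b ≠ 0) :
    ∃ w : L, ‖w‖ ≤ ‖b‖ ∧ ∀ i, ‖b‖ ≤ ‖c i - w‖ := by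
  have hb' : 0 < ‖b‖ := norm_pos_iff.2 hb
  let c' : Fin n → L := fun i => if ‖c i‖ ≤ ‖b‖ then c i else 0
  have hc' : ∀ i, ‖c' i‖ ≤ ‖b‖ := fun i => by
    by_cases h : ‖c i‖ ≤ ‖b‖ <;> simp [c', h]
  let Q : L[X] := X * ∏ i, (X - Polynomial.C (c' i)) - Polynomial.C (b ^ (n + 1))
  have hQ : Q.degree ≠ 0 := by
    have h1 : (X * ∏ i, (X - Polynomial.C (c' i)) : L[X]).degree = ((n + 1 : ℕ) : WithBot ℕ) := by
      rw [degree_mul, degree_prod]; simp [add_comm]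
    have h2 : Q.degree = ((n + 1 : ℕ) : WithBot ℕ) := by
      rw [← h1]
      refine degree_sub_eq_left_of_degree_lt ?_
      rw [h1]
      exact degree_C_le.trans_lt (by exact_mod_cast Nat.succ_pos n)
    rw [h2]; exact_mod_cast Nat.succ_ne_zero n
  obtain ⟨w, hw⟩ := IsAlgClosed.exists_root Q hQ
  have hw' : ‖w‖ * ∏ i, ‖w - c' i‖ = ‖b‖ * ‖b‖ ^ n := by
    have : w * ∏ i, (w - c' i) = b ^ (n + 1) := by
      have := hw.eq_zero
      simpa [Q, eval_prod, sub_eq_zero] using this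
    rw [← norm_prod, ← norm_mul, this, norm_pow, pow_succ']
  have hwb : ‖w‖ ≤ ‖b‖ := by
    by_contra! h
    have h1 : ∀ i, ‖b‖ ≤ ‖w - c' i‖ := fun i => by
      rw [norm_sub_rev]
      by_contra! h'
      have : ‖w‖ ≤ ‖b‖ := by
        have := IsUltrametricDist.norm_sub_le_max_norm (c' i) (c' i - w)
        rw [sub_sub_cancel] at this
        exact this.trans (max_le (hc' i) h'.le)
      linarith
    have h2 : ‖b‖ ^ n ≤ ∏ i, ‖w - c' i‖ := by
      have := Finset.prod_le_prod (s := Finset.univ) (fun (i : Fin n) _ => hb'.le) (fun i _ => h1 i)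
      simpa using this
    have h3 : 0 < ‖b‖ ^ n := by positivity
    nlinarith
  have hle : ∀ i, ‖w - c' i‖ ≤ ‖b‖ := fun i =>
    (IsUltrametricDist.norm_sub_le_max_norm _ _).trans (max_le hwb (hc' i))
  refine ⟨w, hwb, fun i => ?_⟩
  by_cases h : ‖c i‖ ≤ ‖b‖
  · by_contra! hlt
    have hci : ‖w - c' i‖ < ‖b‖ := by simpa [c', h, norm_sub_rev] using hlt
    have h1 : ∏ i, ‖w - c' i‖ < ‖b‖ ^ n := by
      have h2 : ∏ j ∈ Finset.univ.erase i, ‖w - c' j‖ ≤ ‖b‖ ^ (n - 1) := by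
        have := Finset.prod_le_prod (s := Finset.univ.erase i)
          (fun j _ => norm_nonneg (w - c' j)) (fun j _ => hle j)
        simpa using this
      rw [← Finset.mul_prod_erase _ _ (Finset.mem_univ i)]
      obtain ⟨m, rfl⟩ : ∃ m, n = m + 1 := ⟨n - 1, by have := i.pos; omega⟩
      rw [pow_succ']
      calc _ ≤ ‖w - c' i‖ * ‖b‖ ^ m := by gcongr; simpa using h2
        _ < _ := by gcongr
    have h0 : 0 ≤ ∏ i, ‖w - c' i‖ := Finset.prod_nonneg fun _ _ => norm_nonneg _
    nlinarith
  · push Not at h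
    by_contra! hlt
    have := IsUltrametricDist.norm_add_le_max (c i - w) w
    rw [sub_add_cancel] at this
    exact absurd (this.trans (max_le hlt.le hwb)) (not_le.2 h)

open Polynomial in
theorem exists_eval_norm_le_pow_le_prod {L : Type*} [NormedField L] [IsAlgClosed L]
    [IsUltrametricDist L] {φ : L[X]} (hd : 1 ≤ φ.natDegree) {b : L} (hb : b ≠ 0) {R : ℝ}
    (hRb : ‖φ.leadingCoeff‖ * R ^ φ.natDegree = ‖b‖) {n : ℕ} (x : Fin n → L) :
    ∃ z : L, ‖φ.eval z‖ ≤ ‖b‖ ∧ R ^ n ≤ ∏ i, ‖z - x i‖ := by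
  obtain ⟨w, hw, hxw⟩ := exists_norm_le_forall_le_norm_sub (fun i => φ.eval (x i)) hb
  have hdeg : 0 < φ.degree := natDegree_pos_iff_degree_pos.1 hd
  have hφ : φ ≠ 0 := by rintro rfl; simp at hd
  have ha : 0 < ‖φ.leadingCoeff‖ := norm_pos_iff.2 (leadingCoeff_ne_zero.2 hφ)
  have hlc : (φ - Polynomial.C w).leadingCoeff = φ.leadingCoeff :=
    leadingCoeff_sub_of_degree_lt (degree_C_le.trans_lt hdeg)
  have hs : (φ - Polynomial.C w).Splits := IsAlgClosed.splits _
  have hcard : (φ - Polynomial.C w).roots.card = φ.natDegree := by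
    rw [← hs.natDegree_eq_card_roots, natDegree_sub_C]
  have heval : ∀ i, ‖φ.eval (x i) - w‖ =
      ‖φ.leadingCoeff‖ * ((φ - Polynomial.C w).roots.map (fun z => ‖z - x i‖)).prod := fun i => by
    have h := hs.eval_eq_prod_roots (x i)
    rw [hlc, eval_sub, eval_C] at h
    rw [h, norm_mul]
    congr 1
    rw [← coe_nnnorm, ← nnnormHom_apply, map_multiset_prod, Multiset.map_map]
    simp [norm_sub_rev, NNReal.coe_multiset_prod, Multiset.map_map, Function.comp_def]
  have hprod : (R ^ n) ^ φ.natDegree ≤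
      ((φ - Polynomial.C w).roots.map (fun z => ∏ i, ‖z - x i‖)).prod := by
    have h1 : (‖φ.leadingCoeff‖ * R ^ φ.natDegree) ^ n ≤ ∏ i, (‖φ.leadingCoeff‖ *
        ((φ - Polynomial.C w).roots.map (fun z => ‖z - x i‖)).prod) := by
      have := Finset.prod_le_prod (s := Finset.univ) (fun (i : Fin n) _ => norm_nonneg b)
        (fun i _ => (hxw i).trans_eq (heval i))
      simpa [hRb] using this
    rw [Finset.prod_mul_distrib, mul_pow] at h1
    simp only [Finset.prod_const, Finset.card_univ, Fintype.card_fin] at h1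
    have h2 := le_of_mul_le_mul_left h1 (by positivity)
    rw [← pow_mul, mul_comm n, pow_mul]
    exact h2.trans_eq Multiset.prod_map_prod.symm
  rw [← hcard] at hprod
  obtain ⟨z, hz, hRz⟩ := Multiset.exists_le_of_pow_card_le_prod
    (by rw [← Multiset.card_pos, hcard]; exact hd)
    (fun z => Finset.prod_nonneg fun i _ => norm_nonneg _) hprod
  refine ⟨z, ?_, hRz⟩
  rw [mem_roots_sub_C hdeg] at hz
  rwa [hz]

open Polynomial in
theorem exists_pow_le_pairDistProd {L : Type*} [NormedField L] [IsAlgClosed L]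
    [IsUltrametricDist L] {φ : L[X]} (hd : 1 ≤ φ.natDegree) {b : L} (hb : b ≠ 0) {R : ℝ}
    (hR : 0 < R) (hRb : ‖φ.leadingCoeff‖ * R ^ φ.natDegree = ‖b‖) (n : ℕ) :
    ∃ x : Fin n → L, (∀ i, ‖φ.eval (x i)‖ ≤ ‖b‖) ∧
      R ^ (n * (n - 1)) ≤ pairDistProd (fun x y => ‖x - y‖) x := by
  induction n with
  | zero => exact ⟨Fin.elim0, fun i => i.elim0, by simp [pairDistProd]⟩
  | succ n ih =>
    obtain ⟨x, hx, hRx⟩ := ih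
    obtain ⟨z, hz, hRz⟩ := exists_eval_norm_le_pow_le_prod hd hb hRb x
    refine ⟨Fin.cons z x, fun i => by refine Fin.cases ?_ (fun j => ?_) i <;> simp [hz, hx], ?_⟩
    rw [pairDistProd_cons (fun a b => norm_sub_rev a b)]
    calc R ^ ((n + 1) * (n + 1 - 1)) = (R ^ n) ^ 2 * R ^ (n * (n - 1)) := by
          rw [← pow_mul, ← pow_add]
          congr 1
          cases n <;> simp; ring
      _ ≤ _ := by gcongr

open Polynomial in
theorem pairDistProd_le {L : Type*} [NormedField L]
    [IsUltrametricDist L] {φ : L[X]} (hd : 1 ≤ φ.natDegree) {R K : ℝ} (hR : 0 < R) (hK : 1 ≤ K)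
    {n : ℕ} {x : Fin n → L} (hx : ∀ i, ‖φ.eval (x i)‖ ≤ ‖φ.leadingCoeff‖ * R ^ φ.natDegree)
    (hxK : ∀ i, ‖x i‖ ≤ R * K) :
    pairDistProd (fun x y => ‖x - y‖) x ≤ R ^ (n * (n - 1)) * K ^ (2 * φ.natDegree * n) := by
  have hφ : φ ≠ 0 := by rintro rfl; simp at hd
  have ha : 0 < ‖φ.leadingCoeff‖ := norm_pos_iff.2 (leadingCoeff_ne_zero.2 hφ)
  let ψ : L[X] := Polynomial.C φ.leadingCoeff⁻¹ * φ
  have hψm : ψ.Monic := by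
    simp [ψ, Monic, leadingCoeff_mul, hφ]
  have hψd : ψ.natDegree = φ.natDegree := natDegree_C_mul (by simpa using hφ)
  have hψ : ∀ i, ‖ψ.eval (x i)‖ ≤ R ^ φ.natDegree := fun i => by
    simp only [ψ, eval_mul, eval_C, norm_mul, norm_inv]
    rw [inv_mul_le_iff₀ ha]
    exact hx i
  let q : Fin n → L[X] := fun j => ψ ^ (j / φ.natDegree : ℕ) * X ^ (j % φ.natDegree : ℕ)
  have hqm : ∀ j, (q j).Monic := fun j => (hψm.pow _).mul (monic_X_pow _)
  have hqd : ∀ j, (q j).natDegree = j := fun j => by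
    simp only [q]
    rw [(hψm.pow _).natDegree_mul (monic_X_pow _), hψm.natDegree_pow, natDegree_X_pow, hψd]
    exact Nat.div_add_mod' _ _
  have hq : ∀ i j, ‖(q j).eval (x i)‖ ≤ R ^ (j : ℕ) * K ^ φ.natDegree := fun i j => by
    simp only [q, eval_mul, eval_pow, eval_X, norm_mul, norm_pow]
    calc _ ≤ (R ^ φ.natDegree) ^ (j / φ.natDegree : ℕ) * (R * K) ^ (j % φ.natDegree : ℕ) := by
          gcongr
          exacts [hψ i, hxK i]
      _ = R ^ (j : ℕ) * K ^ (j % φ.natDegree : ℕ) := by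
          rw [mul_pow, ← mul_assoc, ← pow_mul, ← pow_add, Nat.div_add_mod]
      _ ≤ _ := by
          gcongr
          exact (Nat.mod_lt _ hd).le
  have hdet : ‖(Matrix.vandermonde x).det‖ ≤ ∏ j : Fin n, (R ^ (j : ℕ) * K ^ φ.natDegree) := by
    rw [Matrix.det_eval_matrixOfPolynomials_eq_det_vandermonde x q hqd hqm, Matrix.det_apply]
    refine IsUltrametricDist.norm_sum_le_of_forall_le_of_nonneg
      (Finset.prod_nonneg fun j _ => by positivity) fun σ _ => ?_
    rw [Units.smul_def, zsmul_eq_mul, norm_mul, norm_prod]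
    have : ‖((Equiv.Perm.sign σ : ℤ) : L)‖ = 1 := by
      rcases Int.units_eq_one_or (Equiv.Perm.sign σ) with h | h <;> simp [h]
    rw [this, one_mul]
    exact Finset.prod_le_prod (fun _ _ => norm_nonneg _) fun j _ => hq _ _
  rw [pairDistProd_eq_norm_det_vandermonde_sq]
  calc _ ≤ (∏ j : Fin n, (R ^ (j : ℕ) * K ^ φ.natDegree)) ^ 2 := by gcongr
    _ = _ := by
      rw [Finset.prod_mul_distrib, Finset.prod_pow_eq_pow_sum, Fin.sum_univ_eq_sum_range (fun i => i),
        mul_pow, ← pow_mul, Finset.sum_range_id_mul_two]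
      simp only [Finset.prod_const, Finset.card_univ, Fintype.card_fin]
      rw [← pow_mul, ← pow_mul]
      congr 2
      ring

open Polynomial in
theorem exists_one_le_forall_norm_le_mul {L : Type*} [NormedField L] {φ : L[X]}
    (hd : 1 ≤ φ.natDegree) (M : ℝ) {R : ℝ} (hR : 0 < R) :
    ∃ K : ℝ, 1 ≤ K ∧ ∀ z : L, ‖φ.eval z‖ ≤ M → ‖z‖ ≤ R * K := by
  have h := φ.tendsto_norm_atTop (natDegree_pos_iff_degree_pos.1 hd)
    (Filter.tendsto_comap (f := (fun z : L => ‖z‖)) (x := Filter.atTop))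
  have h' := h.eventually_gt_atTop M
  rw [Filter.eventually_comap] at h'
  obtain ⟨C, hC⟩ := Filter.eventually_atTop.1 h'
  refine ⟨max 1 (C / R), le_max_left _ _, fun z hz => ?_⟩
  by_contra! hlt
  have : C ≤ ‖z‖ := by
    have : C = R * (C / R) := by field_simp
    rw [this]
    exact le_trans (by gcongr; exact le_max_right _ _) hlt.le
  exact absurd (hC _ this z rfl) (not_lt.2 hz)

open Polynomial in
theorem transDiam_lemniscate {L : Type*} [NormedField L] [IsAlgClosed L]
    [IsUltrametricDist L] {φ : L[X]} (hd : 1 ≤ φ.natDegree) {b : L} (hb : b ≠ 0) {R : ℝ}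
    (hR : 0 < R) (hRb : ‖φ.leadingCoeff‖ * R ^ φ.natDegree = ‖b‖) :
    transDiam (fun x y => ‖x - y‖) {z : L | ‖φ.eval z‖ ≤ ‖b‖} = R := by
  obtain ⟨K, hK, hKB⟩ := exists_one_le_forall_norm_le_mul hd ‖b‖ hR
  have hcast : ∀ n : ℕ, ((n + 2 : ℕ) : ℝ) * (((n + 2 : ℕ) : ℝ) - 1) =
      (((n + 2) * (n + 2 - 1) : ℕ) : ℝ) := fun n => by
    rw [Nat.cast_mul, Nat.cast_sub (by omega)]; simp
  have hne : ∀ n : ℕ, (n + 2) * (n + 2 - 1) ≠ 0 := fun n => by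
    simp
  have hnonneg : ∀ {n : ℕ} (x : Fin n → L), 0 ≤ pairDistProd (fun x y => ‖x - y‖) x := fun x => by
    rw [pairDistProd_eq_norm_det_vandermonde_sq]; positivity
  have hub : ∀ n : ℕ, ∀ r ∈ {r : ℝ | ∃ x : Fin (n + 2) → L,
      (∀ i, x i ∈ {z : L | ‖φ.eval z‖ ≤ ‖b‖}) ∧ r = pairDistProd (fun x y => ‖x - y‖) x ^
        ((((n + 2 : ℕ) : ℝ) * (((n + 2 : ℕ) : ℝ) - 1))⁻¹)},
      r ≤ R * K ^ (2 * φ.natDegree * ((n : ℝ) + 1)⁻¹) := by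
    rintro n r ⟨x, hx, rfl⟩
    have h := pairDistProd_le hd hR hK (x := x) (fun i => (hx i).trans_eq hRb.symm)
      (fun i => hKB _ (hx i))
    calc _ ≤ (R ^ ((n + 2) * (n + 2 - 1)) * K ^ (2 * φ.natDegree * (n + 2))) ^
          ((((n + 2 : ℕ) : ℝ) * (((n + 2 : ℕ) : ℝ) - 1))⁻¹) := by
            refine Real.rpow_le_rpow (hnonneg x) h ?_
            rw [hcast]; positivity
      _ = _ := by
        rw [Real.mul_rpow (by positivity) (by positivity)]
        congr 1
        · rw [hcast, Real.pow_rpow_inv_natCast hR.le (hne n)]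
        · rw [← Real.rpow_natCast, ← Real.rpow_mul (by positivity)]
          congr 1
          push_cast
          have : (n : ℝ) + 2 - 1 = n + 1 := by ring
          rw [this]
          field_simp
  have hlb : ∀ n : ℕ, R ≤ nthDiam (fun x y => ‖x - y‖) {z : L | ‖φ.eval z‖ ≤ ‖b‖} (n + 2) := by
    intro n
    obtain ⟨x, hx, hRx⟩ := exists_pow_le_pairDistProd hd hb hR hRb (n + 2)
    refine le_csSup_of_le ⟨_, hub n⟩ ⟨x, hx, rfl⟩ ?_
    rw [hcast, ← Real.pow_rpow_inv_natCast hR.le (hne n)]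
    exact Real.rpow_le_rpow (by positivity) (by simpa using hRx) (by positivity)
  refine le_antisymm ?_ (le_ciInf hlb)
  have hlim : Filter.Tendsto (fun n : ℕ => R * K ^ (2 * φ.natDegree * ((n : ℝ) + 1)⁻¹))
      Filter.atTop (nhds R) := by
    have h1 : Filter.Tendsto (fun n : ℕ => 2 * (φ.natDegree : ℝ) * ((n : ℝ) + 1)⁻¹)
        Filter.atTop (nhds 0) := by
      simpa using (tendsto_one_div_add_atTop_nhds_zero_nat (𝕜 := ℝ)).const_mul
        (2 * (φ.natDegree : ℝ))
    simpa using ((Real.continuousAt_const_rpow (by positivity : K ≠ 0)).tendsto.comp h1).const_mul R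
  refine ge_of_tendsto' hlim fun n => ?_
  refine (ciInf_le ⟨R, by rintro _ ⟨m, rfl⟩; exact hlb m⟩ n).trans ?_
  obtain ⟨x, hx, -⟩ := exists_pow_le_pairDistProd hd hb hR hRb (n + 2)
  exact csSup_le ⟨_, x, hx, rfl⟩ (hub n)

/-- Over an algebraically closed field `L`, complete with respect to a
nontrivial non-archimedean absolute value, the lemniscate `B = {z : |φ(z)| ≤ M}` (with
`φ` of degree `d ≥ 1`, leading coefficient `a_d`, and `M` in the value group of `L`)
has transfinite diameter `(M/|a_d|)^(1/d)`; in particular the closed disc of radius `M`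
has transfinite diameter `M`. -/
theorem stmt4 {L : Type*} [NormedField L] [IsAlgClosed L] [CompleteSpace L]
    (hnontriv : ∃ x : L, 1 < ‖x‖)
    (hna : ∀ x y : L, ‖x + y‖ ≤ max ‖x‖ ‖y‖)
    (φ : Polynomial L) (hd : 1 ≤ φ.natDegree)
    (M : ℝ) (hM : ∃ x : L, x ≠ 0 ∧ ‖x‖ = M) :
    transDiam (fun x y => ‖x - y‖) {z : L | ‖Polynomial.eval z φ‖ ≤ M} =
        (M / ‖φ.leadingCoeff‖) ^ ((φ.natDegree : ℝ)⁻¹) ∧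
      transDiam (fun x y => ‖x - y‖) {z : L | ‖z‖ ≤ M} = M := by
  have : IsUltrametricDist L :=
    IsUltrametricDist.isUltrametricDist_of_forall_norm_add_le_max_norm hna
  obtain ⟨b, hb, rfl⟩ := hM
  have hb' : 0 < ‖b‖ := norm_pos_iff.2 hb
  have hφ : φ ≠ 0 := by rintro rfl; simp at hd
  have ha : 0 < ‖φ.leadingCoeff‖ := norm_pos_iff.2 (Polynomial.leadingCoeff_ne_zero.2 hφ)
  constructor
  · refine transDiam_lemniscate hd hb (by positivity) ?_
    rw [Real.rpow_inv_natCast_pow (by positivity) (by omega)]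
    field_simp
  · simpa using transDiam_lemniscate (φ := Polynomial.X) (by simp) hb hb' (by simp)
end

section
/- Let L be an algebraically closed field complete with respect to a nontrivial absolute value |·|, and let φ ∈ L[z] be a polynomial of degree d ≥ 2 with leading coefficient a_d. If {S_n} is a sequence of finite subsets of L such that #S_n → ∞ and (1/#S_n) Σ_{z∈S_n} ĥ_φ(z) → 0, then limsup_n d(S_n) ≤ |a_d|^{−1/(d−1)}. -/
open Filter

/-- `log⁺ t = log (max t 1)`. -/
noncomputable def logPlus (t : ℝ) : ℝ := Real.log (max t 1)

/-- The `n`-th iterate of the polynomial map `z ↦ φ(z)`. -/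
noncomputable def polyIter {L : Type*} [CommRing L] (φ : Polynomial L) (n : ℕ) : L → L :=
  (fun w => Polynomial.eval w φ)^[n]

/-- The canonical local height `ĥ_φ(z) = lim_{n → ∞} d^{-n} log⁺ ‖φ^n(z)‖`
(the limit exists; `Filter.limUnder` extracts it). -/
noncomputable def canonicalLocalHeight {L : Type*} [NormedField L] (φ : Polynomial L)
    (z : L) : ℝ :=
  limUnder atTop (fun n : ℕ => ((φ.natDegree : ℝ) ^ n)⁻¹ * logPlus ‖polyIter φ n z‖)

/-- For a finite subset `T` of cardinality `N`, the geometric mean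
`d(T) = ∏_{x ≠ y ∈ T} ‖x - y‖ ^ (1/(N(N-1)))` of the pairwise distances. -/
noncomputable def finsetDiam {L : Type*} [NormedField L] (T : Finset L) : ℝ :=
  letI := Classical.decEq L
  (∏ x ∈ T, ∏ y ∈ T, if x = y then 1 else ‖x - y‖) ^
    (((T.card : ℝ) * ((T.card : ℝ) - 1))⁻¹)

open Polynomial in
lemma norm_eval_le_sum_coeff_mul {L : Type*} [NormedField L] (p : L[X]) {n : ℕ}
    (hn : p.natDegree ≤ n) (w : L) :
    ‖p.eval w‖ ≤ (∑ i ∈ Finset.range (n + 1), ‖p.coeff i‖) * max ‖w‖ 1 ^ n := by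
  rw [eval_eq_sum_range' (Nat.lt_succ_of_le hn), Finset.sum_mul]
  refine (norm_sum_le _ _).trans (Finset.sum_le_sum fun i hi => ?_)
  rw [norm_mul, norm_pow]
  gcongr
  calc ‖w‖ ^ i ≤ max ‖w‖ 1 ^ i := by gcongr; exact le_max_left _ _
    _ ≤ max ‖w‖ 1 ^ n := pow_le_pow_right₀ (le_max_right _ _)
      (Nat.lt_succ_iff.mp (Finset.mem_range.mp hi))

open Polynomial in
lemma exists_max_norm_pow_le_mul_max_norm_eval {L : Type*} [NormedField L] (φ : L[X])
    (hd : 1 ≤ φ.natDegree) :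
    ∃ K : ℝ, 1 ≤ K ∧ ∀ w : L, max ‖w‖ 1 ^ φ.natDegree ≤ K * max ‖φ.eval w‖ 1 := by
  set d := φ.natDegree with hdd
  set a := ‖φ.leadingCoeff‖ with ha
  have ha0 : 0 < a := by
    rw [ha, norm_pos_iff, leadingCoeff_ne_zero]
    rintro rfl
    simp [hdd] at hd
  set M := ∑ i ∈ Finset.range (d - 1 + 1), ‖φ.eraseLead.coeff i‖ with hM
  have hM0 : 0 ≤ M := Finset.sum_nonneg fun _ _ => norm_nonneg _
  refine ⟨1 + 2 / a + (2 * M / a) ^ d, ?_, fun w => ?_⟩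
  · have : 0 ≤ 2 / a := by positivity
    have : 0 ≤ (2 * M / a) ^ d := by positivity
    linarith
  set F := max ‖φ.eval w‖ 1 with hF
  have hF1 : 1 ≤ F := le_max_right _ _
  have h2a : 0 ≤ 2 / a * F := by positivity
  have h2M : 0 ≤ (2 * M / a) ^ d := by positivity
  rcases le_total ‖w‖ 1 with hw | hw
  · rw [max_eq_right hw, one_pow]
    nlinarith
  rw [max_eq_left hw]
  rcases le_total ‖w‖ (2 * M / a) with hwM | hwM
  · have : ‖w‖ ^ d ≤ (2 * M / a) ^ d := by gcongr
    nlinarith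
  have hlow := norm_eval_le_sum_coeff_mul φ.eraseLead (eraseLead_natDegree_le φ) w
  rw [← hdd, ← hM, max_eq_left hw] at hlow
  have heq : φ.leadingCoeff * w ^ d = φ.eval w - φ.eraseLead.eval w := by
    have h := congrArg (eval w) (eraseLead_add_C_mul_X_pow φ)
    rw [eval_add, eval_mul, eval_C, eval_pow, eval_X, ← hdd] at h
    rw [← h, add_sub_cancel_left]
  have hle : a * ‖w‖ ^ d ≤ F + M * ‖w‖ ^ (d - 1) := by
    calc a * ‖w‖ ^ d = ‖φ.eval w - φ.eraseLead.eval w‖ := by rw [← heq, norm_mul, norm_pow]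
      _ ≤ ‖φ.eval w‖ + ‖φ.eraseLead.eval w‖ := norm_sub_le _ _
      _ ≤ F + M * ‖w‖ ^ (d - 1) := add_le_add (le_max_left _ _) hlow
  have hM2 : 2 * (M * ‖w‖ ^ (d - 1)) ≤ a * ‖w‖ ^ d := by
    have h1 : 2 * M ≤ ‖w‖ * a := (div_le_iff₀ ha0).mp hwM
    obtain ⟨e, he⟩ : ∃ e, d = e + 1 := ⟨d - 1, by omega⟩
    rw [he, Nat.add_sub_cancel, pow_succ]
    have : 0 ≤ ‖w‖ ^ e := by positivity
    nlinarith
  have : ‖w‖ ^ d ≤ 2 / a * F := by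
    rw [div_mul_eq_mul_div, le_div_iff₀ ha0]
    linarith
  nlinarith

lemma exp_logPlus (t : ℝ) : Real.exp (logPlus t) = max t 1 :=
  Real.exp_log (lt_max_of_lt_right one_pos)

lemma logPlus_nonneg (t : ℝ) : 0 ≤ logPlus t :=
  Real.log_nonneg (le_max_right _ _)

open Polynomial in
lemma exists_abs_logPlus_eval_sub_le {L : Type*} [NormedField L] (φ : L[X])
    (hd : 1 ≤ φ.natDegree) :
    ∃ B : ℝ, ∀ w : L, |logPlus ‖φ.eval w‖ - φ.natDegree * logPlus ‖w‖| ≤ B := by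
  obtain ⟨K, hK1, hK⟩ := exists_max_norm_pow_le_mul_max_norm_eval φ hd
  set M := 1 + ∑ i ∈ Finset.range (φ.natDegree + 1), ‖φ.coeff i‖ with hM
  have hM1 : 1 ≤ M := le_add_of_nonneg_right (Finset.sum_nonneg fun _ _ => norm_nonneg _)
  refine ⟨Real.log K + Real.log M, fun w => ?_⟩
  have hw : 1 ≤ max ‖w‖ 1 := le_max_right _ _
  have hpow : 1 ≤ max ‖w‖ 1 ^ φ.natDegree := one_le_pow₀ hw
  have hF : 1 ≤ max ‖φ.eval w‖ 1 := le_max_right _ _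
  have hupper : max ‖φ.eval w‖ 1 ≤ M * max ‖w‖ 1 ^ φ.natDegree := by
    apply max_le
    · have := norm_eval_le_sum_coeff_mul φ le_rfl w
      rw [hM, add_mul]
      linarith
    · nlinarith
  have h1 := Real.log_le_log (by positivity) (hK w)
  have h2 := Real.log_le_log (by positivity) hupper
  rw [Real.log_mul (by positivity) (by positivity), Real.log_pow] at h1 h2
  have h3 := Real.log_nonneg hK1
  have h4 := Real.log_nonneg hM1
  unfold logPlus
  rw [abs_le]
  constructor <;> linarith

open Polynomial in
lemma exists_tendsto_canonicalLocalHeight {L : Type*} [NormedField L] (φ : L[X])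
    (hd : 2 ≤ φ.natDegree) :
    ∃ C : ℝ, ∀ z : L,
      Tendsto (fun n : ℕ => ((φ.natDegree : ℝ) ^ n)⁻¹ * logPlus ‖polyIter φ n z‖) atTop
        (nhds (canonicalLocalHeight φ z)) ∧ logPlus ‖z‖ ≤ canonicalLocalHeight φ z + C := by
  obtain ⟨B, hB⟩ := exists_abs_logPlus_eval_sub_le φ (by omega)
  have hd2 : (2 : ℝ) ≤ φ.natDegree := by exact_mod_cast hd
  set d : ℝ := (φ.natDegree : ℝ)
  have hB0 : 0 ≤ B := (abs_nonneg _).trans (hB 0)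
  refine ⟨B / (1 - d⁻¹), fun z => ?_⟩
  set h : ℕ → ℝ := fun n => (d ^ n)⁻¹ * logPlus ‖polyIter φ n z‖ with hh
  have hr : d⁻¹ < 1 := inv_lt_one_of_one_lt₀ (by linarith)
  have hstep : ∀ n, dist (h n) (h (n + 1)) ≤ B * d⁻¹ ^ n := fun n => by
    have hsucc : polyIter φ (n + 1) z = φ.eval (polyIter φ n z) :=
      Function.iterate_succ_apply' _ _ _
    have hdiff : h (n + 1) - h n = (d ^ (n + 1))⁻¹ *
        (logPlus ‖φ.eval (polyIter φ n z)‖ - d * logPlus ‖polyIter φ n z‖) := by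
      simp only [hh, hsucc]
      field_simp
      ring
    rw [dist_comm, Real.dist_eq, hdiff, abs_mul, abs_of_nonneg (by positivity), inv_pow, mul_comm]
    refine mul_le_mul (hB _) ?_ (by positivity) hB0
    gcongr <;> linarith
  have hlim : Tendsto h atTop (nhds (canonicalLocalHeight φ z)) :=
    (cauchySeq_of_le_geometric _ _ hr hstep).tendsto_limUnder
  refine ⟨hlim, ?_⟩
  have hdist := dist_le_of_le_geometric_of_tendsto₀ _ _ hr hstep hlim
  have h0 : h 0 = logPlus ‖z‖ := by simp [hh, polyIter]
  rw [Real.dist_eq, h0] at hdist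
  linarith [le_abs_self (logPlus ‖z‖ - canonicalLocalHeight φ z)]

lemma canonicalLocalHeight_nonneg {L : Type*} [NormedField L] {φ : Polynomial L}
    (hd : 2 ≤ φ.natDegree) (z : L) : 0 ≤ canonicalLocalHeight φ z := by
  obtain ⟨_, hC⟩ := exists_tendsto_canonicalLocalHeight φ hd
  exact ge_of_tendsto' (hC z).1 fun n => mul_nonneg (by positivity) (logPlus_nonneg _)

lemma canonicalLocalHeight_eval {L : Type*} [NormedField L] {φ : Polynomial L}
    (hd : 2 ≤ φ.natDegree) (z : L) :
    canonicalLocalHeight φ (φ.eval z) = φ.natDegree * canonicalLocalHeight φ z := by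
  obtain ⟨_, hC⟩ := exists_tendsto_canonicalLocalHeight φ hd
  refine tendsto_nhds_unique (hC (φ.eval z)).1 ?_
  have hd0 : (φ.natDegree : ℝ) ≠ 0 := by
    have : φ.natDegree ≠ 0 := by omega
    exact_mod_cast this
  refine (((hC z).1.comp (tendsto_add_atTop_nat 1)).const_mul (φ.natDegree : ℝ)).congr fun n => ?_
  have hiter : polyIter φ (n + 1) z = polyIter φ n (φ.eval z) := Function.iterate_succ_apply _ _ _
  simp only [Function.comp_apply, hiter, pow_succ]
  field_simp

open Polynomial in
/-- Monic polynomials of every degree, built from iterates of `φ` by expanding the degree in base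
`deg φ`, whose size is controlled by the canonical local height up to a logarithmic error. -/
lemma exists_monic_norm_eval_le {L : Type*} [NormedField L] {φ : L[X]} (hd : 2 ≤ φ.natDegree) :
    ∃ A : ℝ, 0 ≤ A ∧ ∀ j : ℕ, ∃ q : L[X], q.Monic ∧ q.natDegree = j ∧ ∀ z : L,
      ‖q.eval z‖ ≤ Real.exp (-(j * (Real.log ‖φ.leadingCoeff‖ / (φ.natDegree - 1))) +
        A * (Nat.log 2 j + 1) + j * canonicalLocalHeight φ z) := by
  obtain ⟨B, hB⟩ := exists_tendsto_canonicalLocalHeight φ hd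
  have hφ0 : φ.leadingCoeff ≠ 0 := by
    rw [leadingCoeff_ne_zero]
    rintro rfl
    simp at hd
  have hd2 : (2 : ℝ) ≤ φ.natDegree := by exact_mod_cast hd
  set β := Real.log ‖φ.leadingCoeff‖ / ((φ.natDegree : ℝ) - 1) with hβ
  have hα : ‖φ.leadingCoeff‖ = Real.exp (((φ.natDegree : ℝ) - 1) * β) := by
    rw [hβ, mul_div_cancel₀ _ (by linarith), Real.exp_log (norm_pos_iff.mpr hφ0)]
  have hz : ∀ z : L, ‖z‖ ≤ Real.exp (canonicalLocalHeight φ z + B) := fun z =>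
    (le_max_left _ _).trans ((exp_logPlus ‖z‖).symm.le.trans (Real.exp_le_exp.mpr (hB z).2))
  set D : ℝ := |B + β| with hD
  have hDB : B + β ≤ D := le_abs_self _
  have hD0 : 0 ≤ D := abs_nonneg _
  refine ⟨φ.natDegree * D, by positivity, fun j => ?_⟩
  induction j using Nat.strong_induction_on with
  | _ j ih =>
  rcases lt_or_ge j φ.natDegree with hj | hj
  · refine ⟨X ^ j, monic_X_pow j, natDegree_X_pow j, fun z => ?_⟩
    rw [eval_pow, eval_X, norm_pow]
    calc ‖z‖ ^ j ≤ Real.exp (canonicalLocalHeight φ z + B) ^ j := by gcongr; exact hz z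
      _ = Real.exp (j * (canonicalLocalHeight φ z + B)) := by rw [← Real.exp_nat_mul]
      _ ≤ _ := by
        apply Real.exp_le_exp.mpr
        have hjd : (j : ℝ) ≤ φ.natDegree := by exact_mod_cast hj.le
        have h1 : (j : ℝ) * (B + β) ≤ φ.natDegree * D :=
            (mul_le_mul_of_nonneg_left hDB j.cast_nonneg).trans
              (mul_le_mul_of_nonneg_right hjd hD0)
        have h2 : 0 ≤ φ.natDegree * D * (Nat.log 2 j : ℝ) := by positivity
        linarith
  · obtain ⟨m, r, hm, hr, hjr, hlog⟩ : ∃ m r : ℕ, 1 ≤ m ∧ r < φ.natDegree ∧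
        m * φ.natDegree + r = j ∧ Nat.log 2 m + 1 ≤ Nat.log 2 j := by
      have hm : 1 ≤ j / φ.natDegree := (Nat.one_le_div_iff (by omega)).mpr hj
      refine ⟨j / φ.natDegree, j % φ.natDegree, hm, Nat.mod_lt _ (by omega),
        Nat.div_add_mod' _ _, ?_⟩
      rw [← Nat.log_mul_base one_lt_two (by omega)]
      refine Nat.log_mono_right ?_
      calc j / φ.natDegree * 2 ≤ j / φ.natDegree * φ.natDegree := by gcongr
        _ ≤ j := Nat.div_mul_le_self _ _
    have hmj : m < j := by nlinarith
    obtain ⟨q, hq, hqm, hqz⟩ := ih m hmj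
    have hdeg : (q.comp φ).natDegree = m * φ.natDegree := by rw [natDegree_comp, hqm]
    have hlead : (q.comp φ).leadingCoeff = φ.leadingCoeff ^ m := by
      rw [leadingCoeff_comp (by omega), hq.leadingCoeff, one_mul, hqm]
    have hmonic : (C (φ.leadingCoeff ^ m)⁻¹ * q.comp φ).Monic := by
      rw [Monic, leadingCoeff_mul, leadingCoeff_C, hlead, inv_mul_cancel₀ (pow_ne_zero _ hφ0)]
    refine ⟨C (φ.leadingCoeff ^ m)⁻¹ * q.comp φ * X ^ r, hmonic.mul (monic_X_pow r), ?_,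
      fun z => ?_⟩
    · rw [hmonic.natDegree_mul (monic_X_pow r), natDegree_X_pow,
        natDegree_C_mul (inv_ne_zero (pow_ne_zero _ hφ0)), hdeg, hjr]
    · have hrd : (r : ℝ) ≤ φ.natDegree := by exact_mod_cast hr.le
      have hjr' : (j : ℝ) = m * φ.natDegree + r := by exact_mod_cast hjr.symm
      have hlog' : (Nat.log 2 m : ℝ) + 1 ≤ Nat.log 2 j := by exact_mod_cast hlog
      have h1 := hqz (φ.eval z)
      rw [canonicalLocalHeight_eval hd] at h1
      rw [eval_mul, eval_mul, eval_C, eval_comp, eval_pow, eval_X, norm_mul, norm_mul, norm_inv,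
        norm_pow, norm_pow, hα]
      calc _ ≤ (Real.exp (((φ.natDegree : ℝ) - 1) * β) ^ m)⁻¹ *
            Real.exp (-(m * β) + φ.natDegree * D * (Nat.log 2 m + 1) +
              m * (φ.natDegree * canonicalLocalHeight φ z)) *
            Real.exp (canonicalLocalHeight φ z + B) ^ r := by gcongr; exact hz z
        _ = Real.exp (-(m * (((φ.natDegree : ℝ) - 1) * β)) + (-(m * β) +
              φ.natDegree * D * (Nat.log 2 m + 1) +
              m * (φ.natDegree * canonicalLocalHeight φ z)) +
              r * (canonicalLocalHeight φ z + B)) := by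
          rw [← Real.exp_nat_mul, ← Real.exp_nat_mul, ← Real.exp_neg, ← Real.exp_add,
            ← Real.exp_add]
        _ ≤ _ := by
          apply Real.exp_le_exp.mpr
          rw [hjr']
          have h2 : (r : ℝ) * (B + β) ≤ φ.natDegree * D :=
            (mul_le_mul_of_nonneg_left hDB r.cast_nonneg).trans
              (mul_le_mul_of_nonneg_right hrd hD0)
          have h3 : φ.natDegree * D * ((Nat.log 2 m : ℝ) + 1) ≤
            φ.natDegree * D * (Nat.log 2 j : ℝ) := by gcongr
          linarith

lemma norm_det_le_factorial_mul_prod {L : Type*} [NormedField L] {N : ℕ}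
    (M : Matrix (Fin N) (Fin N) L) (u b : Fin N → ℝ) (h : ∀ i j, ‖M i j‖ ≤ u i * b j) :
    ‖M.det‖ ≤ N.factorial * ((∏ i, u i) * ∏ j, b j) := by
  rw [Matrix.det_apply]
  refine (norm_sum_le _ _).trans ?_
  have hterm : ∀ σ ∈ (Finset.univ : Finset (Equiv.Perm (Fin N))),
      ‖Equiv.Perm.sign σ • ∏ i, M (σ i) i‖ ≤ (∏ i, u i) * ∏ j, b j := fun σ _ => by
    have hsign : ‖Equiv.Perm.sign σ • ∏ i, M (σ i) i‖ = ‖∏ i, M (σ i) i‖ := by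
      rcases Int.units_eq_one_or (Equiv.Perm.sign σ) with hs | hs <;> simp [hs]
    rw [hsign, norm_prod, ← Equiv.prod_comp σ u, ← Finset.prod_mul_distrib]
    exact Finset.prod_le_prod (fun _ _ => norm_nonneg _) fun i _ => h _ _
  refine (Finset.sum_le_card_nsmul _ _ _ hterm).trans_eq ?_
  rw [Finset.card_univ, Fintype.card_perm, Fintype.card_fin, nsmul_eq_mul]

lemma prod_prod_ite_norm_sub_eq_norm_det_vandermonde_sq {L : Type*} [NormedField L] {N : ℕ}
    (v : Fin N → L) :
    (∏ i, ∏ j, if i = j then 1 else ‖v i - v j‖) = ‖(Matrix.vandermonde v).det‖ ^ 2 := by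
  have hprod : ‖(Matrix.vandermonde v).det‖ = ∏ i, ∏ j, if i < j then ‖v i - v j‖ else 1 := by
    rw [Matrix.det_vandermonde, norm_prod]
    refine Finset.prod_congr rfl fun i _ => ?_
    rw [norm_prod, ← Finset.prod_filter]
    refine Finset.prod_congr (by ext; simp) fun j _ => norm_sub_rev _ _
  have hsplit : ∀ i j : Fin N, (if i = j then 1 else ‖v i - v j‖) =
      (if i < j then ‖v i - v j‖ else 1) * (if j < i then ‖v j - v i‖ else 1) := fun i j => by
    rcases lt_trichotomy i j with h | h | h
    · simp [h, h.ne, h.not_gt]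
    · simp [h]
    · simp [h, h.ne', h.not_gt, norm_sub_rev]
  simp_rw [hsplit, Finset.prod_mul_distrib]
  rw [Finset.prod_comm (f := fun i j => if j < i then ‖v j - v i‖ else 1), ← hprod, sq]

lemma finsetDiam_nonneg {L : Type*} [NormedField L] (T : Finset L) : 0 ≤ finsetDiam T := by
  unfold finsetDiam
  refine Real.rpow_nonneg (Finset.prod_nonneg fun x _ => Finset.prod_nonneg fun y _ => ?_) _
  split_ifs <;> positivity

lemma finsetDiam_eq_norm_det_vandermonde {L : Type*} [NormedField L] (T : Finset L) :
    finsetDiam T = (‖(Matrix.vandermonde fun i : Fin T.card => (T.equivFin.symm i : L)).det‖ ^ 2) ^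
      (((T.card : ℝ) * ((T.card : ℝ) - 1))⁻¹) := by
  classical
  rw [← prod_prod_ite_norm_sub_eq_norm_det_vandermonde_sq]
  unfold finsetDiam
  congr 1
  rw [← Finset.prod_coe_sort T, ← Equiv.prod_comp T.equivFin.symm]
  refine Finset.prod_congr rfl fun i _ => ?_
  rw [← Finset.prod_coe_sort T, ← Equiv.prod_comp T.equivFin.symm]
  refine Finset.prod_congr rfl fun j _ => ?_
  congr 1
  simp

lemma exists_finsetDiam_le {L : Type*} [NormedField L] {φ : Polynomial L}
    (hd : 2 ≤ φ.natDegree) :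
    ∃ A : ℝ, ∀ T : Finset L, 2 ≤ T.card →
      finsetDiam T ≤ Real.exp (-(Real.log ‖φ.leadingCoeff‖ / (φ.natDegree - 1)) +
        2 * ((T.card : ℝ)⁻¹ * ∑ z ∈ T, canonicalLocalHeight φ z) +
        2 * (A * (Real.log T.card + 1) / (T.card - 1))) := by
  obtain ⟨A, hA, hq⟩ := exists_monic_norm_eval_le hd
  choose q hmonic hdeg hbound using hq
  refine ⟨1 + A * (1 + (Real.log 2)⁻¹), fun T hT => ?_⟩
  rw [finsetDiam_eq_norm_det_vandermonde]
  set N := T.card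
  set v : Fin N → L := fun i => (T.equivFin.symm i : L)
  set β := Real.log ‖φ.leadingCoeff‖ / ((φ.natDegree : ℝ) - 1)
  set H := ∑ z ∈ T, canonicalLocalHeight φ z with hH
  have hN2 : (2 : ℝ) ≤ N := by exact_mod_cast hT
  have hsum : ∑ i, canonicalLocalHeight φ (v i) = H := by
    rw [hH, ← Finset.sum_coe_sort T, ← Equiv.sum_comp T.equivFin.symm]
  have hj1 : ∀ j : Fin N, (j : ℝ) ≤ N - 1 := fun j => by
    have : (j : ℕ) + 1 ≤ N := j.2
    have : ((j : ℕ) : ℝ) + 1 ≤ N := by exact_mod_cast this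
    linarith
  set E := A * (Nat.log 2 N + 1 : ℝ) with hE
  have hdet : ‖(Matrix.vandermonde v).det‖ ≤ N.factorial *
      ((∏ i, Real.exp ((N - 1) * canonicalLocalHeight φ (v i))) *
        ∏ j : Fin N, Real.exp (-(j * β) + E)) := by
    rw [Matrix.det_eval_matrixOfPolynomials_eq_det_vandermonde v (fun j => q j)
      (fun j => hdeg j) (fun j => hmonic j)]
    refine norm_det_le_factorial_mul_prod _ _ _ fun i j => ?_
    rw [Matrix.of_apply, ← Real.exp_add]
    refine (hbound j (v i)).trans (Real.exp_le_exp.mpr ?_)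
    have h1 : (j : ℝ) * canonicalLocalHeight φ (v i) ≤ (N - 1) * canonicalLocalHeight φ (v i) :=
      mul_le_mul_of_nonneg_right (hj1 j) (canonicalLocalHeight_nonneg hd _)
    have h2 : A * (Nat.log 2 j + 1 : ℝ) ≤ E := by
      have : Nat.log 2 j ≤ Nat.log 2 N := Nat.log_mono_right j.2.le
      rw [hE]
      gcongr
    linarith
  have hgauss : ∑ j : Fin N, (j : ℝ) = N * (N - 1) / 2 := by
    rw [Fin.sum_univ_eq_sum_range (fun j => (j : ℝ)) N]
    have := Finset.sum_range_id_mul_two N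
    have : ((∑ i ∈ Finset.range N, i : ℕ) : ℝ) * 2 = N * (N - 1) := by
      rw [← Nat.cast_pred (by omega)]
      exact_mod_cast this
    push_cast at this
    linarith
  have hfact : (N.factorial : ℝ) ≤ Real.exp (N * Real.log N) := by
    rw [Real.exp_nat_mul, Real.exp_log (by linarith)]
    exact_mod_cast Nat.factorial_le_pow N
  have hEle : E ≤ A * (1 + (Real.log 2)⁻¹) * (Real.log N + 1) := by
    have h1 : (Nat.log 2 N : ℝ) ≤ Real.log N * (Real.log 2)⁻¹ := by
      have := Real.natLog_le_logb N 2
      rwa [Real.logb, Nat.cast_ofNat, div_eq_mul_inv] at this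
    have h2 : 0 ≤ Real.log N := Real.log_nonneg (by linarith)
    have h3 : 0 ≤ (Real.log 2)⁻¹ := by positivity
    rw [hE, mul_assoc]
    gcongr
    nlinarith
  have hdet' : ‖(Matrix.vandermonde v).det‖ ≤ Real.exp (N * Real.log N +
      ((N - 1) * H + (-(N * (N - 1) / 2 * β) + N * E))) := by
    refine hdet.trans ?_
    rw [← Real.exp_sum, ← Real.exp_sum, ← Finset.mul_sum, hsum, Finset.sum_add_distrib,
      Finset.sum_neg_distrib, ← Finset.sum_mul, hgauss, Finset.sum_const, Finset.card_univ,
      Fintype.card_fin, nsmul_eq_mul, Real.exp_add (N * Real.log N), Real.exp_add ((N - 1) * H)]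
    gcongr
  have hNN : (0 : ℝ) < N * (N - 1) := by nlinarith
  calc _ ≤ (Real.exp (N * Real.log N +
      ((N - 1) * H + (-(N * (N - 1) / 2 * β) + N * E))) ^ 2) ^ (((N : ℝ) * (N - 1))⁻¹) := by
        gcongr
    _ = Real.exp (-β + 2 * ((N : ℝ)⁻¹ * H) + 2 * ((Real.log N + E) / (N - 1))) := by
        rw [← Real.exp_nat_mul, ← Real.exp_mul]
        congr 1
        have : (N : ℝ) - 1 ≠ 0 := by linarith
        field_simp
        push_cast
        ring
    _ ≤ _ := by
        apply Real.exp_le_exp.mpr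
        have : (0 : ℝ) < N - 1 := by linarith
        gcongr
        linarith

lemma tendsto_log_add_one_div_sub_one (A : ℝ) :
    Tendsto (fun x : ℝ => A * (Real.log x + 1) / (x - 1)) atTop (nhds 0) := by
  have hlog : (fun x : ℝ => A * (Real.log x + 1)) =o[atTop] (fun x : ℝ => x) :=
    (Real.isLittleO_log_id_atTop.add (Asymptotics.isLittleO_const_id_atTop (1 : ℝ))).const_mul_left A
  have hlin : (fun x : ℝ => x) =O[atTop] (fun x : ℝ => x - 1) := by
    refine Asymptotics.IsBigO.of_bound 2 ?_
    filter_upwards [eventually_ge_atTop 2] with x hx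
    rw [Real.norm_of_nonneg (by linarith), Real.norm_of_nonneg (by linarith)]
    linarith
  exact (hlog.trans_isBigO hlin).tendsto_div_nhds_zero

/-- Let `L` be an algebraically closed field complete with respect to a
nontrivial absolute value, `φ ∈ L[z]` of degree `d ≥ 2` with leading coefficient `a_d`.
If `{S_n}` are finite subsets of `L` with `#S_n → ∞` and average canonical local height
tending to `0`, then `limsup d(S_n) ≤ ‖a_d‖^(-1/(d-1))`. -/
theorem stmt7 {L : Type*} [NormedField L] [IsAlgClosed L] [CompleteSpace L]
    (hnontriv : ∃ x : L, 1 < ‖x‖)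
    (φ : Polynomial L) (hd : 2 ≤ φ.natDegree)
    (S : ℕ → Finset L)
    (hcard : Tendsto (fun n => (S n).card) atTop atTop)
    (htaut : Tendsto
      (fun n => ((S n).card : ℝ)⁻¹ * ∑ z ∈ S n, canonicalLocalHeight φ z)
      atTop (nhds 0)) :
    limsup (fun n => finsetDiam (S n)) atTop ≤
      ‖φ.leadingCoeff‖ ^ (-(1 : ℝ) / ((φ.natDegree : ℝ) - 1)) := by
  obtain ⟨A, hA⟩ := exists_finsetDiam_le hd
  have hφ : 0 < ‖φ.leadingCoeff‖ := by
    rw [norm_pos_iff, Polynomial.leadingCoeff_ne_zero]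
    rintro rfl
    simp at hd
  have htarget : ‖φ.leadingCoeff‖ ^ (-(1 : ℝ) / ((φ.natDegree : ℝ) - 1)) =
      Real.exp (-(Real.log ‖φ.leadingCoeff‖ / (φ.natDegree - 1)) + 2 * 0 + 2 * 0) := by
    rw [Real.rpow_def_of_pos hφ]
    congr 1
    ring
  have herr := (tendsto_log_add_one_div_sub_one A).comp
    (tendsto_natCast_atTop_atTop.comp hcard)
  have hlim := ((htaut.const_mul 2).const_add
    (-(Real.log ‖φ.leadingCoeff‖ / ((φ.natDegree : ℝ) - 1)))).add (herr.const_mul 2)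
  have hexp := (Real.continuous_exp.tendsto _).comp hlim
  rw [htarget, ← hexp.limsup_eq]
  refine limsup_le_limsup ?_ ?_ hexp.isBoundedUnder_le
  · filter_upwards [hcard.eventually_ge_atTop 2] with n hn using hA (S n) hn
  · exact (isBoundedUnder_of ⟨0, fun n => finsetDiam_nonneg (S n)⟩ :
      IsBoundedUnder (· ≥ ·) atTop fun n => finsetDiam (S n)).isCoboundedUnder_le
end
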